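/- Let 𝔾 be a toroidal grid diagram of grid number n with 4-fold diagram 𝔾₄, and let x₄, y₄ be grid states of 𝔾₄. A rectangle r₄ from x₄ to y₄ determines an equivalence class lying in the image of the natural injection Rect(x,y) ↪ [Rect](x₄,y₄) if and only if both edge lengths of r₄ are fewer than n rows/columns; in particular, any rectangle in 𝔾₄ with an edge spanning at least n rows or at least n columns contains a point of π₄⁻¹(𝕏). Consequently, every equivalence class [r₄] ∈ [Rect](x₄,y₄) with r₄ ∩ π₄⁻¹(𝕏) = ∅ lies in the image of Rect(x,y). -/

import Mathlib

/-!
Combinatorial model of toroidal grid diagrams, their 4-fold covers, and the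
double-point enhanced grid complex (over 𝔽 = ℤ/2ℤ), following Lipshitz and
Ozsváth–Szabó–Sarkar conventions.

* The torus is modelled by `ZMod n × ZMod n`: the horizontal circle `α_j` and
  vertical circle `β_k` meet at the point `(k, j)`; the square `(k, j)` is the
  one with south-west corner at the point `(k, j)`;  the `O`- and `X`-markings
  of column `k` occupy squares `(k, Orow k)` and `(k, Xrow k)`.
* A grid state is a bijection (column ↦ row), i.e. a permutation of `ZMod n`.
* The 4-fold cover `𝔾₄` lives on `ZMod (2n) × ZMod (2n)`, with the covering
  map `pr` reducing coordinates mod `n`.  A grid state of `𝔾₄` is the preimage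
  of a grid state of `𝔾`, so grid states of `𝔾₄` are canonically identified
  with grid states of `𝔾`; similarly the free module `GC` underlying both
  `GC•(𝔾)` and `GC•(𝔾₄)` is the same, and the identification `J₄` is the
  identity map.
* Rectangles are recorded by their two vertical circles (west/east) and two
  horizontal circles (south/north); "rectangle from x₄ to y₄" is the boundary
  condition `∂(∂_α(r + Nr + Er + NEr)) = y₄ - x₄` (and the `∂_β` analogue),
  expressed via corner-point indicator functions.  Each `N,E`-equivalence class
  of rectangles in `𝔾₄` contains exactly one *normalized* representative
  (west circle and south circle in the first fundamental domain), so sums over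
  equivalence classes are sums over normalized representatives.
-/

noncomputable section

open scoped Classical

namespace GridHomology

/-- the ground field `𝔽 = ℤ/2ℤ` -/
abbrev F : Type := ZMod 2

/-- A toroidal grid diagram of grid number `n`. -/
structure GridDiagram (n : ℕ) where
  Orow : ZMod n → ZMod n
  Xrow : ZMod n → ZMod n
  hO : Function.Bijective Orow
  hX : Function.Bijective Xrow
  hOX : ∀ i, Orow i ≠ Xrow i

/-- A grid state: one point on each horizontal and each vertical circle. -/
abbrev GridState (n : ℕ) := Equiv.Perm (ZMod n)

instance twoMulNeZero (n : ℕ) [NeZero n] : NeZero (2 * n) :=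
  ⟨fun h => NeZero.ne n (by omega)⟩

/-- membership in the cyclic (going east/north) interval `[u, v)` -/
def inIco {m : ℕ} (u v k : ZMod m) : Prop := (k - u).val < (v - u).val

/-- membership in the open cyclic interval `(u, v)` -/
def inIoo {m : ℕ} (u v k : ZMod m) : Prop :=
  0 < (k - u).val ∧ (k - u).val < (v - u).val

instance {m : ℕ} (u v k : ZMod m) : Decidable (inIco u v k) :=
  inferInstanceAs (Decidable (_ < _))

instance {m : ℕ} (u v k : ZMod m) : Decidable (inIoo u v k) :=
  inferInstanceAs (Decidable (_ ∧ _))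

/-- Rectangle data on the `m × m` torus: west and east vertical circles,
south and north horizontal circles. -/
structure Rect (m : ℕ) where
  cW : ZMod m
  cE : ZMod m
  rS : ZMod m
  rN : ZMod m
deriving DecidableEq

instance (m : ℕ) [NeZero m] : Fintype (Rect m) :=
  Fintype.ofEquiv (ZMod m × ZMod m × ZMod m × ZMod m)
    { toFun := fun p => ⟨p.1, p.2.1, p.2.2.1, p.2.2.2⟩
      invFun := fun r => ⟨r.cW, r.cE, r.rS, r.rN⟩
      left_inv := fun _ => rfl
      right_inv := fun _ => rfl }

/-- local multiplicity of a rectangle at a square of the torus -/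
def Rect.mult {m : ℕ} (r : Rect m) (sq : ZMod m × ZMod m) : ℕ :=
  if inIco r.cW r.cE sq.1 ∧ inIco r.rS r.rN sq.2 then 1 else 0

/-- `r` is an (embedded, not necessarily empty) rectangle from `x` to `y` in `𝔾`:
its south-west and north-east corners lie in `x`, its south-east and north-west
corners lie in `y`, and `x`, `y` agree away from the two vertical circles of `r`. -/
def IsRectFrom {m : ℕ} (x y : GridState m) (r : Rect m) : Prop :=
  r.cW ≠ r.cE ∧ r.rS ≠ r.rN ∧
  x r.cW = r.rS ∧ x r.cE = r.rN ∧ y r.cW = r.rN ∧ y r.cE = r.rS ∧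
  ∀ k, k ≠ r.cW → k ≠ r.cE → x k = y k

/-- point-measure of a rectangle in `𝔾` at a grid state `w`: the sum over the
points of `w` of the average of the four adjacent local multiplicities -/
def Rect.pm {m : ℕ} [NeZero m] (w : GridState m) (r : Rect m) : ℚ :=
  (∑ k : ZMod m, ((r.mult (k - 1, w k - 1) + r.mult (k, w k - 1) +
      r.mult (k - 1, w k) + r.mult (k, w k) : ℕ) : ℚ)) / 4

/-- `m(r) = #(Int r ∩ x)` -/
def Rect.intCount {m : ℕ} [NeZero m] (x : GridState m) (r : Rect m) : ℕ :=
  (Finset.univ.filter fun k => inIoo r.cW r.cE k ∧ inIoo r.rS r.rN (x k)).card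

/-- `O_i(r)` in `𝔾` -/
def Ocount {m : ℕ} (G : GridDiagram m) (r : Rect m) (i : ZMod m) : ℕ :=
  r.mult (i, G.Orow i)

/-- `X_i(r)` in `𝔾` -/
def Xcount {m : ℕ} (G : GridDiagram m) (r : Rect m) (i : ZMod m) : ℕ :=
  r.mult (i, G.Xrow i)

/-- `r ∩ 𝕏 = ∅` -/
def XDisjoint {m : ℕ} (G : GridDiagram m) (r : Rect m) : Prop :=
  ∀ i, Xcount G r i = 0

/-! ### The 4-fold cover -/

/-- the covering projection `π₄ : 𝔾₄ → 𝔾` on coordinates -/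
def pr {n : ℕ} (a : ZMod (2 * n)) : ZMod n :=
  ZMod.castHom (dvd_mul_left n 2) (ZMod n) a

/-- indicator function (as a formal sum of points) of the lifted grid state `x₄` -/
def stInd {n : ℕ} (x : GridState n) (p : ZMod (2 * n) × ZMod (2 * n)) : ℤ :=
  if x (pr p.1) = pr p.2 then 1 else 0

/-- `∂(∂_α r)` as a formal sum of points: `SE + NW − SW − NE` -/
def cornerA {m : ℕ} (r : Rect m) (p : ZMod m × ZMod m) : ℤ :=
  (if p = (r.cE, r.rS) then 1 else 0) + (if p = (r.cW, r.rN) then 1 else 0)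
    - (if p = (r.cW, r.rS) then 1 else 0) - (if p = (r.cE, r.rN) then 1 else 0)

/-- `∂(∂_β r)` as a formal sum of points: `NE + SW − SE − NW` -/
def cornerB {m : ℕ} (r : Rect m) (p : ZMod m × ZMod m) : ℤ :=
  (if p = (r.cE, r.rN) then 1 else 0) + (if p = (r.cW, r.rS) then 1 else 0)
    - (if p = (r.cE, r.rS) then 1 else 0) - (if p = (r.cW, r.rN) then 1 else 0)

/-- northward translation `N` by `n` rows -/
def trN {n : ℕ} (r : Rect (2 * n)) : Rect (2 * n) :=
  ⟨r.cW, r.cE, r.rS + (n : ZMod (2 * n)), r.rN + (n : ZMod (2 * n))⟩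

/-- eastward translation `E` by `n` columns -/
def trE {n : ℕ} (r : Rect (2 * n)) : Rect (2 * n) :=
  ⟨r.cW + (n : ZMod (2 * n)), r.cE + (n : ZMod (2 * n)), r.rS, r.rN⟩

/-- `r` is a rectangle from `x₄` to `y₄` in the 4-fold diagram `𝔾₄`:
`∂(∂_α (r + Nr + Er + NEr)) = y₄ − x₄` and `∂(∂_β (r + Nr + Er + NEr)) = x₄ − y₄`. -/
def IsRect4From {n : ℕ} (x y : GridState n) (r : Rect (2 * n)) : Prop :=
  r.cW ≠ r.cE ∧ r.rS ≠ r.rN ∧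
  (∀ p, cornerA r p + cornerA (trN r) p + cornerA (trE r) p + cornerA (trN (trE r)) p
      = stInd y p - stInd x p) ∧
  (∀ p, cornerB r p + cornerB (trN r) p + cornerB (trE r) p + cornerB (trN (trE r)) p
      = stInd x p - stInd y p)

/-- the canonical (normalized) representative of each `{r, Nr, Er, NEr}`
equivalence class: west and south coordinates lie in the first fundamental domain -/
def normal4 {n : ℕ} (r : Rect (2 * n)) : Prop := r.cW.val < n ∧ r.rS.val < n

instance {n : ℕ} (r : Rect (2 * n)) : Decidable (normal4 r) :=
  inferInstanceAs (Decidable (_ ∧ _))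

/-- `O_i[r₄]`: total multiplicity of `r₄` at the four lifts of `O_i` -/
def O4count {n : ℕ} [NeZero n] (G : GridDiagram n) (r : Rect (2 * n)) (i : ZMod n) : ℕ :=
  ∑ p : ZMod (2 * n) × ZMod (2 * n),
    if pr p.1 = i ∧ pr p.2 = G.Orow i then r.mult p else 0

/-- `X_i[r₄]` -/
def X4count {n : ℕ} [NeZero n] (G : GridDiagram n) (r : Rect (2 * n)) (i : ZMod n) : ℕ :=
  ∑ p : ZMod (2 * n) × ZMod (2 * n),
    if pr p.1 = i ∧ pr p.2 = G.Xrow i then r.mult p else 0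

/-- `r₄ ∩ π₄⁻¹(𝕏) = ∅` -/
def XDisjoint4 {n : ℕ} [NeZero n] (G : GridDiagram n) (r : Rect (2 * n)) : Prop :=
  ∀ i, X4count G r i = 0

/-- point-measure of a domain (an integer-valued multiplicity function on the
squares of `𝔾₄`) at the lifted grid state `w₄` -/
def pm4 {n : ℕ} [NeZero n] (w : GridState n) (ψ : ZMod (2 * n) × ZMod (2 * n) → ℤ) : ℚ :=
  (∑ p : ZMod (2 * n) × ZMod (2 * n),
    if w (pr p.1) = pr p.2 then
      ((ψ (p.1 - 1, p.2 - 1) + ψ (p.1, p.2 - 1) + ψ (p.1 - 1, p.2) + ψ p : ℤ) : ℚ)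
    else 0) / 4

/-- a rectangle of `𝔾₄` viewed as a domain -/
def Rect.dom4 {n : ℕ} (r : Rect (2 * n)) : ZMod (2 * n) × ZMod (2 * n) → ℤ :=
  fun p => (r.mult p : ℤ)

/-- point-measure `p_{w₄}[r₄]` of a rectangle of `𝔾₄` -/
def rpm4 {n : ℕ} [NeZero n] (w : GridState n) (r : Rect (2 * n)) : ℚ :=
  pm4 w r.dom4

/-- `m[r₄] = (p_{x₄}[r₄] + p_{y₄}[r₄] − 1)/2`, as a rational number -/
def mQ4 {n : ℕ} [NeZero n] (x y : GridState n) (r : Rect (2 * n)) : ℚ :=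
  (rpm4 x r + rpm4 y r - 1) / 2

/-- `m[r₄]` as a natural number (the exponent of `v`) -/
def m4 {n : ℕ} [NeZero n] (x y : GridState n) (r : Rect (2 * n)) : ℕ :=
  (⌊mQ4 x y r⌋).toNat

/-! ### Maslov and Alexander gradings (via the planar counting function `J`) -/

/-- the points of a planar fundamental domain associated to `f`, in doubled
coordinates (grid states at even positions, markings at odd positions) -/
def ptsOf {m : ℕ} [NeZero m] (f : ZMod m → ZMod m) (off : ℕ) : Finset (ℕ × ℕ) :=
  Finset.univ.image fun k => (2 * k.val + off, 2 * (f k).val + off)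

/-- `I(P,Q)`: pairs `(p,q)` with `q` strictly above and strictly to the right of `p` -/
def Icnt (P Q : Finset (ℕ × ℕ)) : ℕ :=
  ∑ p ∈ P, (Q.filter fun q => p.1 < q.1 ∧ p.2 < q.2).card

/-- `J(P,Q) = (I(P,Q) + I(Q,P))/2` -/
def Jq (P Q : Finset (ℕ × ℕ)) : ℚ := ((Icnt P Q : ℚ) + (Icnt Q P : ℚ)) / 2

/-- the Maslov-type grading `J(x,x) − 2 J(x,P) + J(P,P) + 1` for markings `P` -/
def MaslovOf {m : ℕ} [NeZero m] (f : ZMod m → ZMod m) (x : GridState m) : ℚ :=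
  Jq (ptsOf (⇑x) 0) (ptsOf (⇑x) 0) - 2 * Jq (ptsOf (⇑x) 0) (ptsOf f 1)
    + Jq (ptsOf f 1) (ptsOf f 1) + 1

/-- the Maslov grading `M(x) = M_𝕆(x)` -/
def MaslovO {m : ℕ} [NeZero m] (G : GridDiagram m) (x : GridState m) : ℚ :=
  MaslovOf G.Orow x

/-- `M_𝕏(x)` -/
def MaslovX {m : ℕ} [NeZero m] (G : GridDiagram m) (x : GridState m) : ℚ :=
  MaslovOf G.Xrow x

/-- the Alexander grading `A(x) = (M_𝕆(x) − M_𝕏(x) − (n−1))/2` -/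
def Alex {m : ℕ} [NeZero m] (G : GridDiagram m) (x : GridState m) : ℚ :=
  (MaslovO G x - MaslovX G x - ((m : ℚ) - 1)) / 2

/-! ### The double-point enhanced grid complex -/

/-- the ring `𝔽[V₁, …, V_n, v]`: `V_i = X (some i)`, `v = X none` -/
abbrev Rng (n : ℕ) : Type := MvPolynomial (Option (ZMod n)) F

/-- the free `𝔽[V₁,…,V_n,v]`-module on the set of grid states; it underlies both
`GC•(𝔾)` and `GC•(𝔾₄)` (their grid states being canonically identified) -/
abbrev GC (n : ℕ) := GridState n →₀ Rng n

/-- the variable `V_i` -/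
def Vv {n : ℕ} (i : ZMod n) : Rng n := MvPolynomial.X (some i)

/-- the double-point variable `v` -/
def vV {n : ℕ} : Rng n := MvPolynomial.X none

/-- the `𝔽[V₁,…,V_n,v]`-linear map determined by values on grid states -/
def basisMap {n : ℕ} (f : GridState n → GC n) : GC n →ₗ[Rng n] GC n :=
  Finsupp.lsum (Rng n) fun x => LinearMap.toSpanSingleton (Rng n) (GC n) (f x)

/-- the weight `V₁^{O₁[r₄]} ⋯ V_n^{O_n[r₄]} v^{m[r₄]}` of a rectangle of `𝔾₄` -/
def wt4 {n : ℕ} [NeZero n] (G : GridDiagram n) (x y : GridState n) (r : Rect (2 * n)) :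
    Rng n :=
  (∏ i : ZMod n, Vv i ^ O4count G r i) * vV ^ m4 x y r

/-- the differential `∂₄•` of `GC•(𝔾₄)`: counts `N,E`-equivalence classes of
rectangles (via their normalized representatives) disjoint from `π₄⁻¹(𝕏)` -/
def diff4 {n : ℕ} [NeZero n] (G : GridDiagram n) : GC n →ₗ[Rng n] GC n :=
  basisMap fun x => ∑ y : GridState n,
    ∑ r ∈ Finset.univ.filter
        (fun r : Rect (2 * n) => IsRect4From x y r ∧ normal4 r ∧ XDisjoint4 G r),
      Finsupp.single y (wt4 G x y r)

/-- the weight of a rectangle of `𝔾` -/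
def wtB {n : ℕ} [NeZero n] (G : GridDiagram n) (x : GridState n) (r : Rect n) : Rng n :=
  (∏ i : ZMod n, Vv i ^ Ocount G r i) * vV ^ Rect.intCount x r

/-- the differential `∂•` of the double-point enhanced grid complex `GC•(𝔾)` -/
def diffB {n : ℕ} [NeZero n] (G : GridDiagram n) : GC n →ₗ[Rng n] GC n :=
  basisMap fun x => ∑ y : GridState n,
    ∑ r ∈ Finset.univ.filter
        (fun r : Rect n => IsRectFrom x y r ∧ XDisjoint G r),
      Finsupp.single y (wtB G x r)

/-- `z` is homogeneous of bidegree `(d, s)` for the (Maslov, Alexander) bigrading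
extended by `M(V₁^{k₁}⋯V_n^{k_n} v^m ⋅ x) = M(x) − 2Σkᵢ + 2m`,
`A(V₁^{k₁}⋯V_n^{k_n} v^m ⋅ x) = A(x) − Σkᵢ`. -/
def IsHomog {n : ℕ} [NeZero n] (G : GridDiagram n) (z : GC n) (d s : ℚ) : Prop :=
  ∀ (y : GridState n) (k : Option (ZMod n) →₀ ℕ), MvPolynomial.coeff k (z y) ≠ 0 →
    (MaslovO G y - 2 * ∑ i : ZMod n, (k (some i) : ℚ) + 2 * (k none : ℚ) = d) ∧
    (Alex G y - ∑ i : ZMod n, (k (some i) : ℚ) = s)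

/-- a linear map is homogeneous of degree `(a, b)` -/
def MapHomog {n : ℕ} [NeZero n] (G G' : GridDiagram n) (φ : GC n →ₗ[Rng n] GC n)
    (a b : ℚ) : Prop :=
  ∀ z d s, IsHomog G z d s → IsHomog G' (φ z) (d + a) (s + b)

/-- `𝔾` represents a knot: following the link (column `i` joins its `O` to the `X`
in the same row, etc.) visits every column -/
def IsKnot {n : ℕ} (G : GridDiagram n) : Prop :=
  ∀ i j : ZMod n, ∃ k : ℕ,
    (((Equiv.ofBijective G.Orow G.hO).trans (Equiv.ofBijective G.Xrow G.hX).symm) ^ k) i = j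

/-- the homotopy operator `𝓗_{X_j}•` counting equivalence classes of rectangles in
`𝔾₄` crossing the lifts of `X_j` exactly once and no other `X`-marking -/
def HXmap {n : ℕ} [NeZero n] (G : GridDiagram n) (j : ZMod n) : GC n →ₗ[Rng n] GC n :=
  basisMap fun x => ∑ y : GridState n,
    ∑ r ∈ Finset.univ.filter (fun r : Rect (2 * n) =>
        IsRect4From x y r ∧ normal4 r ∧ X4count G r j = 1 ∧
        ∀ k, k ≠ j → X4count G r k = 0),
      Finsupp.single y (wt4 G x y r)

/-! ### Commutation moves, pentagons and hexagons

`𝔾` and `𝔾'` differ by commuting the (adjacent) columns `c−1` and `c`; they are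
drawn on a common torus, sharing all markings and all circles except that the
vertical circle `β_c` of `𝔾` is replaced in `𝔾'` by a curve `γ_c` which passes
to the west of the marking line within the rows of the cyclic interval
`J = [h₁, h₂)` (which contains the markings of column `c−1`) and to the east of
it in the complementary rows (which contain the markings of column `c`);
`γ_c` crosses `β_c` at two points `a` (just south of the row-circle `h₂`) and
`b` (just south of `h₁`).  Grid states of `𝔾'` are again recorded as
permutations (the `γ`-point in row `j` replacing the `β_c`-point). -/

structure CommData (n : ℕ) where
  G : GridDiagram n
  G' : GridDiagram n
  c : ZMod n
  h₁ : ZMod n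
  h₂ : ZMod n
  hne : h₁ ≠ h₂
  hOA : inIco h₁ h₂ (G.Orow (c - 1))
  hXA : inIco h₁ h₂ (G.Xrow (c - 1))
  hOB : ¬ inIco h₁ h₂ (G.Orow c)
  hXB : ¬ inIco h₁ h₂ (G.Xrow c)
  hO'A : G'.Orow (c - 1) = G.Orow c
  hO'B : G'.Orow c = G.Orow (c - 1)
  hX'A : G'.Xrow (c - 1) = G.Xrow c
  hX'B : G'.Xrow c = G.Xrow (c - 1)
  hO' : ∀ k, k ≠ c - 1 → k ≠ c → G'.Orow k = G.Orow k
  hX' : ∀ k, k ≠ c - 1 → k ≠ c → G'.Xrow k = G.Xrow k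

/-- Pentagon data in the 4-fold torus `T₄`: the underlying rectangle
`I₄(p)` of `𝔾₄`, the side of the curved edge (`left = true` means the curved
vertical edge is the east edge of the rectangle), and the lifted height `hh`
of the crossing point (`a` or `b`) serving as the fifth corner. -/
structure Pent (n : ℕ) where
  rect : Rect (2 * n)
  left : Bool
  hh : ZMod (2 * n)
deriving DecidableEq

instance (n : ℕ) [NeZero n] : Fintype (Pent n) :=
  Fintype.ofEquiv (Rect (2 * n) × Bool × ZMod (2 * n))
    { toFun := fun p => ⟨p.1, p.2.1, p.2.2⟩
      invFun := fun p => ⟨p.rect, p.left, p.hh⟩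
      left_inv := fun _ => rfl
      right_inv := fun _ => rfl }

/-- the distinguished vertical edge lies on a lift of the curved circle -/
def onCedge {n : ℕ} (C : CommData n) (p : Pent n) : Prop :=
  if p.left then pr p.rect.cE = C.c else pr p.rect.cW = C.c

/-- the crossing point (at height just below the row circle `h`) lies strictly
inside the vertical extent of the rectangle -/
def heightOK {n : ℕ} (r : Rect (2 * n)) (h : ZMod (2 * n)) : Prop :=
  0 < (h - r.rS).val ∧ (h - r.rS).val ≤ (r.rN - r.rS).val

/-- a pentagon from `x₄ ∈ S₄(𝔾₄)` to `y₄' ∈ S₄(𝔾₄')` (with fifth corner at a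
lift of the distinguished point `a`) -/
def IsPentA {n : ℕ} (C : CommData n) (x y' : GridState n) (p : Pent n) : Prop :=
  IsRect4From x y' p.rect ∧ pr p.hh = C.h₂ ∧ onCedge C p ∧ heightOK p.rect p.hh

/-- a pentagon from `y₄' ∈ S₄(𝔾₄')` to `x₄ ∈ S₄(𝔾₄)` (fifth corner at a lift of `b`) -/
def IsPentB {n : ℕ} (C : CommData n) (y' x : GridState n) (p : Pent n) : Prop :=
  IsRect4From y' x p.rect ∧ pr p.hh = C.h₁ ∧ onCedge C p ∧ heightOK p.rect p.hh

/-- the rows along which the boundary of the pentagon runs along `γ` rather than `β_c` -/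
def detourA {n : ℕ} [NeZero n] (p : Pent n) : Finset (ZMod (2 * n)) :=
  if p.left then Finset.univ.filter (fun j => inIco p.rect.rS p.hh j)
  else Finset.univ.filter (fun j => inIco p.hh p.rect.rN j)

def detourB {n : ℕ} [NeZero n] (p : Pent n) : Finset (ZMod (2 * n)) :=
  if p.left then Finset.univ.filter (fun j => inIco p.hh p.rect.rN j)
  else Finset.univ.filter (fun j => inIco p.rect.rS p.hh j)

/-- marking-count correction along a curved edge: in a detour row `j`, if `γ` is
west (`π₄ j ∈ J`) the bigon sliver carries the column-`(c−1)` marking, otherwise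
it carries the column-`c` marking; the sliver is gained or lost according to
whether the region lies east (`east = true`) or west of the curved circle. -/
def adj {n : ℕ} [NeZero n] (C : CommData n) (f : ZMod n → ZMod n) (east : Bool)
    (D : Finset (ZMod (2 * n))) (i : ZMod n) : ℤ :=
  ∑ j ∈ D,
    if inIco C.h₁ C.h₂ (pr j) then
      (if i = C.c - 1 ∧ f (C.c - 1) = pr j then (if east then 1 else -1) else 0)
    else
      (if i = C.c ∧ f C.c = pr j then (if east then -1 else 1) else 0)

/-- `O_i[p₄]` for a pentagon counted by `P•` -/
def pentOA {n : ℕ} [NeZero n] (C : CommData n) (p : Pent n) (i : ZMod n) : ℤ :=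
  (O4count C.G p.rect i : ℤ) + adj C C.G.Orow (!p.left) (detourA p) i

def pentXA {n : ℕ} [NeZero n] (C : CommData n) (p : Pent n) (i : ZMod n) : ℤ :=
  (X4count C.G p.rect i : ℤ) + adj C C.G.Xrow (!p.left) (detourA p) i

def pentXDisjA {n : ℕ} [NeZero n] (C : CommData n) (p : Pent n) : Prop :=
  ∀ i, pentXA C p i = 0

def pentOB {n : ℕ} [NeZero n] (C : CommData n) (p : Pent n) (i : ZMod n) : ℤ :=
  (O4count C.G p.rect i : ℤ) + adj C C.G.Orow (!p.left) (detourB p) i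

def pentXB {n : ℕ} [NeZero n] (C : CommData n) (p : Pent n) (i : ZMod n) : ℤ :=
  (X4count C.G p.rect i : ℤ) + adj C C.G.Xrow (!p.left) (detourB p) i

def pentXDisjB {n : ℕ} [NeZero n] (C : CommData n) (p : Pent n) : Prop :=
  ∀ i, pentXB C p i = 0

/-- the weight `V₁^{O₁[p₄]}⋯V_n^{O_n[p₄]} v^{m[p₄]}`, with `m[p₄] = m[I₄(p₄)]` -/
def pentWtA {n : ℕ} [NeZero n] (C : CommData n) (x y' : GridState n) (p : Pent n) : Rng n :=
  (∏ i : ZMod n, Vv i ^ (pentOA C p i).toNat) * vV ^ m4 x y' p.rect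

def pentWtB {n : ℕ} [NeZero n] (C : CommData n) (y' x : GridState n) (p : Pent n) : Rng n :=
  (∏ i : ZMod n, Vv i ^ (pentOB C p i).toNat) * vV ^ m4 y' x p.rect

/-- the pentagon-counting map `P• : GC•(𝔾₄) → GC•(𝔾₄')` -/
def Pmap {n : ℕ} [NeZero n] (C : CommData n) : GC n →ₗ[Rng n] GC n :=
  basisMap fun x => ∑ y' : GridState n,
    ∑ p ∈ Finset.univ.filter (fun p : Pent n =>
        IsPentA C x y' p ∧ normal4 p.rect ∧ pentXDisjA C p),
      Finsupp.single y' (pentWtA C x y' p)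

/-- the pentagon-counting map `(P•)' : GC•(𝔾₄') → GC•(𝔾₄)` -/
def P'map {n : ℕ} [NeZero n] (C : CommData n) : GC n →ₗ[Rng n] GC n :=
  basisMap fun y' => ∑ x : GridState n,
    ∑ p ∈ Finset.univ.filter (fun p : Pent n =>
        IsPentB C y' x p ∧ normal4 p.rect ∧ pentXDisjB C p),
      Finsupp.single x (pentWtB C y' x p)

/-- Hexagon data: the underlying rectangle `I₄(h₄)` of `𝔾₄`, the side of its
curved edge, and the lifted heights of its two crossing-point corners
(`ha` a lift of `a`, `hb` a lift of `b`). -/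
structure Hex (n : ℕ) where
  rect : Rect (2 * n)
  left : Bool
  ha : ZMod (2 * n)
  hb : ZMod (2 * n)
deriving DecidableEq

instance (n : ℕ) [NeZero n] : Fintype (Hex n) :=
  Fintype.ofEquiv (Rect (2 * n) × Bool × ZMod (2 * n) × ZMod (2 * n))
    { toFun := fun p => ⟨p.1, p.2.1, p.2.2.1, p.2.2.2⟩
      invFun := fun p => ⟨p.rect, p.left, p.ha, p.hb⟩
      left_inv := fun _ => rfl
      right_inv := fun _ => rfl }

def onCedgeH {n : ℕ} (C : CommData n) (h : Hex n) : Prop :=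
  if h.left then pr h.rect.cE = C.c else pr h.rect.cW = C.c

/-- a hexagon from `x₄` to `y₄` (both states of `𝔾₄`) -/
def IsHex {n : ℕ} (C : CommData n) (x y : GridState n) (h : Hex n) : Prop :=
  IsRect4From x y h.rect ∧ pr h.ha = C.h₂ ∧ pr h.hb = C.h₁ ∧ onCedgeH C h ∧
  heightOK h.rect h.ha ∧ heightOK h.rect h.hb

/-- the rows between the two crossing-point corners of a hexagon -/
def detourH {n : ℕ} [NeZero n] (h : Hex n) : Finset (ZMod (2 * n)) :=
  if (h.ha - h.rect.rS).val < (h.hb - h.rect.rS).val then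
    Finset.univ.filter (fun j => inIco h.ha h.hb j)
  else Finset.univ.filter (fun j => inIco h.hb h.ha j)

def hexO {n : ℕ} [NeZero n] (C : CommData n) (h : Hex n) (i : ZMod n) : ℤ :=
  (O4count C.G h.rect i : ℤ) + adj C C.G.Orow (!h.left) (detourH h) i

def hexX {n : ℕ} [NeZero n] (C : CommData n) (h : Hex n) (i : ZMod n) : ℤ :=
  (X4count C.G h.rect i : ℤ) + adj C C.G.Xrow (!h.left) (detourH h) i

def hexXDisj {n : ℕ} [NeZero n] (C : CommData n) (h : Hex n) : Prop :=
  ∀ i, hexX C h i = 0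

def hexWt {n : ℕ} [NeZero n] (C : CommData n) (x y : GridState n) (h : Hex n) : Rng n :=
  (∏ i : ZMod n, Vv i ^ (hexO C h i).toNat) * vV ^ m4 x y h.rect

/-- the hexagon-counting map `H• : GC•(𝔾₄) → GC•(𝔾₄)` -/
def Hmap {n : ℕ} [NeZero n] (C : CommData n) : GC n →ₗ[Rng n] GC n :=
  basisMap fun x => ∑ y : GridState n,
    ∑ h ∈ Finset.univ.filter (fun h : Hex n =>
        IsHex C x y h ∧ normal4 h.rect ∧ hexXDisj C h),
      Finsupp.single y (hexWt C x y h)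

/-! ### Double-point enhanced grid homology -/

def cycles {n : ℕ} [NeZero n] (G : GridDiagram n) : Submodule (Rng n) (GC n) :=
  LinearMap.ker (diffB G)

def bdrIn {n : ℕ} [NeZero n] (G : GridDiagram n) : Submodule (Rng n) ↥(cycles G) :=
  Submodule.comap (cycles G).subtype (LinearMap.range (diffB G))

instance GHquotInst {n : ℕ} [NeZero n] (G : GridDiagram n) :
    HasQuotient ↥(cycles G) (Submodule (Rng n) ↥(cycles G)) :=
  Submodule.hasQuotient (R := Rng n) (M := ↥(cycles G))

/-- the double-point enhanced grid homology `GH•(𝔾)` -/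
abbrev GH {n : ℕ} [NeZero n] (G : GridDiagram n) := ↥(cycles G) ⧸ bdrIn G

/-- a homology class is homogeneous of degree `(d,s)` if it has a homogeneous
cycle representative -/
def GHhomog {n : ℕ} [NeZero n] (G : GridDiagram n) (h : GH G) (d s : ℚ) : Prop :=
  ∃ w : ↥(cycles G), (Submodule.Quotient.mk w : GH G) = h ∧ IsHomog G (w : GC n) d s

/-! ### Commutation and stabilization moves as relations on grid diagrams -/

/-- `𝔾` and `𝔾'` differ by a column commutation move -/
def IsColComm {n : ℕ} (G G' : GridDiagram n) : Prop :=
  ∃ C : CommData n, C.G = G ∧ C.G' = G'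

/-- the transposed grid diagram (exchanging the roles of rows and columns) -/
def GridDiagram.transpose {n : ℕ} (G : GridDiagram n) : GridDiagram n where
  Orow := ⇑(Equiv.ofBijective G.Orow G.hO).symm
  Xrow := ⇑(Equiv.ofBijective G.Xrow G.hX).symm
  hO := (Equiv.ofBijective G.Orow G.hO).symm.bijective
  hX := (Equiv.ofBijective G.Xrow G.hX).symm.bijective
  hOX := by
    intro i h
    apply G.hOX ((Equiv.ofBijective G.Orow G.hO).symm i)
    have h1 : G.Orow ((Equiv.ofBijective G.Orow G.hO).symm i) = i :=
      Equiv.ofBijective_apply_symm_apply G.Orow G.hO i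
    have h2 : G.Xrow ((Equiv.ofBijective G.Xrow G.hX).symm i) = i :=
      Equiv.ofBijective_apply_symm_apply G.Xrow G.hX i
    rw [h1, h, h2]

/-- `𝔾` and `𝔾'` differ by a row commutation move -/
def IsRowComm {n : ℕ} (G G' : GridDiagram n) : Prop :=
  IsColComm G.transpose G'.transpose

/-- collapse map identifying `a` and `a+1` (used to destabilize) -/
def coll {n : ℕ} (a k : ZMod (n + 1)) : ZMod n :=
  (a.val : ZMod n) + (((k - a).val - 1 : ℕ) : ZMod n)

/-- `𝔾'` is obtained from `𝔾` by a stabilization with new 2×2 block at columns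
`c', c'+1` and rows `r', r'+1`; the empty square of the block sits at the corner
selected by `(ec, er)` (east column?, north row?), and `xty` records whether the
block carries two `X`-markings (type `X:·`) or two `O`-markings (type `O:·`).
E.g. `(ec, er, xty) = (false, false, true)` is type `X:SW`, with
`O₁ = (c'+1, r'+1)`, `X₁ = (c', r'+1)`, `X₂ = (c'+1, r')`. -/
def IsStabAt {n : ℕ} (G : GridDiagram n) (G' : GridDiagram (n + 1))
    (c' r' : ZMod (n + 1)) (ec er xty : Bool) : Prop :=
  (if xty then
    G'.Orow (if ec then c' else c' + 1) = (if er then r' else r' + 1) ∧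
    G'.Xrow (if ec then c' + 1 else c') = (if er then r' else r' + 1) ∧
    G'.Xrow (if ec then c' else c' + 1) = (if er then r' + 1 else r') ∧
    G.Xrow (c'.val : ZMod n) = (r'.val : ZMod n) ∧
    G.Orow (c'.val : ZMod n) = coll r' (G'.Orow (if ec then c' + 1 else c'))
  else
    G'.Xrow (if ec then c' else c' + 1) = (if er then r' else r' + 1) ∧
    G'.Orow (if ec then c' + 1 else c') = (if er then r' else r' + 1) ∧
    G'.Orow (if ec then c' else c' + 1) = (if er then r' + 1 else r') ∧
    G.Orow (c'.val : ZMod n) = (r'.val : ZMod n) ∧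
    G.Xrow (c'.val : ZMod n) = coll r' (G'.Xrow (if ec then c' + 1 else c'))) ∧
  (∀ k : ZMod (n + 1), k ≠ c' → k ≠ c' + 1 →
    G.Orow (coll c' k) = coll r' (G'.Orow k) ∧ G.Xrow (coll c' k) = coll r' (G'.Xrow k))

/-- `𝔾'` is obtained from `𝔾` by a stabilization move of one of the standard types -/
def IsStab {n : ℕ} (G : GridDiagram n) (G' : GridDiagram (n + 1)) : Prop :=
  ∃ c' r' ec er xty, IsStabAt G G' c' r' ec er xty

/-! ### The stabilization machinery (type `X:SW`) for the 4-fold complexes -/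

/-- projection of `GC•(𝔾₄')` onto the span `I₄` of states containing the
distinguished point `c = (c'+1, r'+1)` -/
def pI {n : ℕ} (c' r' : ZMod (n + 1)) : GC (n + 1) →ₗ[Rng (n + 1)] GC (n + 1) :=
  basisMap fun x => if x (c' + 1) = r' + 1 then Finsupp.single x 1 else 0

/-- projection onto the complementary span `N₄` -/
def pN {n : ℕ} (c' r' : ZMod (n + 1)) : GC (n + 1) →ₗ[Rng (n + 1)] GC (n + 1) :=
  basisMap fun x => if x (c' + 1) = r' + 1 then 0 else Finsupp.single x 1

/-- the submodule `I₄` -/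
def Isub {n : ℕ} (c' r' : ZMod (n + 1)) : Submodule (Rng (n + 1)) (GC (n + 1)) :=
  Finsupp.supported (Rng (n + 1)) (Rng (n + 1)) {x : GridState (n + 1) | x (c' + 1) = r' + 1}

/-- the submodule `N₄` -/
def Nsub {n : ℕ} (c' r' : ZMod (n + 1)) : Submodule (Rng (n + 1)) (GC (n + 1)) :=
  Finsupp.supported (Rng (n + 1)) (Rng (n + 1)) {x : GridState (n + 1) | x (c' + 1) ≠ r' + 1}

/-- the components `∂_{I₄}^{I₄}`, `∂_{I₄}^{N₄}`, `∂_{N₄}^{N₄}` of `∂₄•` -/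
def dII {n : ℕ} [NeZero (n + 1)] (G' : GridDiagram (n + 1)) (c' r' : ZMod (n + 1)) :
    GC (n + 1) →ₗ[Rng (n + 1)] GC (n + 1) :=
  pI c' r' ∘ₗ diff4 G' ∘ₗ pI c' r'

def dIN {n : ℕ} [NeZero (n + 1)] (G' : GridDiagram (n + 1)) (c' r' : ZMod (n + 1)) :
    GC (n + 1) →ₗ[Rng (n + 1)] GC (n + 1) :=
  pN c' r' ∘ₗ diff4 G' ∘ₗ pI c' r'

def dNN {n : ℕ} [NeZero (n + 1)] (G' : GridDiagram (n + 1)) (c' r' : ZMod (n + 1)) :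
    GC (n + 1) →ₗ[Rng (n + 1)] GC (n + 1) :=
  pN c' r' ∘ₗ diff4 G' ∘ₗ pN c' r'

/-- section of the column collapse map, avoiding the new column `c'+1` -/
def sect {n : ℕ} (a : ZMod (n + 1)) (k : ZMod n) : ZMod (n + 1) :=
  a + (if k - (a.val : ZMod n) = 0 then 0
       else (((k - (a.val : ZMod n)).val + 1 : ℕ) : ZMod (n + 1)))

def stCollFun {n : ℕ} (c' r' : ZMod (n + 1)) (x : GridState (n + 1)) :
    ZMod n → ZMod n :=
  fun k => coll r' (x (sect c' k))

/-- the destabilized grid state `x` corresponding to `x' = x ∪ {c}` -/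
def stColl {n : ℕ} (c' r' : ZMod (n + 1)) (x : GridState (n + 1)) : GridState n :=
  if h : Function.Bijective (stCollFun c' r' x) then Equiv.ofBijective _ h else 1

/-- the promoted module `GC•(𝔾₄)[V₁]`: the free `𝔽[V₁,…,V_n,v]`-module on the
grid states of the destabilized diagram -/
abbrev GCP (n : ℕ) := GridState n →₀ Rng (n + 1)

def basisMapP {n : ℕ} (f : GridState n → GCP n) : GCP n →ₗ[Rng (n + 1)] GCP n :=
  Finsupp.lsum (Rng (n + 1)) fun x => LinearMap.toSpanSingleton (Rng (n + 1)) (GCP n) (f x)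

/-- the identification `e₄` (extended by zero on `N₄`) -/
def e4map {n : ℕ} (c' r' : ZMod (n + 1)) : GC (n + 1) →ₗ[Rng (n + 1)] GCP n :=
  Finsupp.lsum (Rng (n + 1)) fun x =>
    LinearMap.toSpanSingleton (Rng (n + 1)) (GCP n)
      (if x (c' + 1) = r' + 1 then Finsupp.single (stColl c' r' x) (1 : Rng (n + 1)) else 0)

/-- renaming of the variables of the destabilized diagram into those of `𝔾'` -/
def renUp {n : ℕ} (c' : ZMod (n + 1)) : Rng n →+* Rng (n + 1) :=
  (MvPolynomial.rename (Option.map (sect c')) :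
      MvPolynomial (Option (ZMod n)) F →ₐ[F] MvPolynomial (Option (ZMod (n + 1))) F).toRingHom

/-- the differential of the promoted complex `GC•(𝔾₄)[V₁]` -/
def diffP {n : ℕ} [NeZero n] (G : GridDiagram n) (c' : ZMod (n + 1)) :
    GCP n →ₗ[Rng (n + 1)] GCP n :=
  basisMapP fun x => ∑ y : GridState n,
    ∑ r ∈ Finset.univ.filter
        (fun r : Rect (2 * n) => IsRect4From x y r ∧ normal4 r ∧ XDisjoint4 G r),
      Finsupp.single y (renUp c' (wt4 G x y r))

/-- homogeneity on the promoted complex -/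
def IsHomogP {n : ℕ} [NeZero n] (G : GridDiagram n) (z : GCP n) (d s : ℚ) : Prop :=
  ∀ (y : GridState n) (k : Option (ZMod (n + 1)) →₀ ℕ), MvPolynomial.coeff k (z y) ≠ 0 →
    (MaslovO G y - 2 * ∑ i : ZMod (n + 1), (k (some i) : ℚ) + 2 * (k none : ℚ) = d) ∧
    (Alex G y - ∑ i : ZMod (n + 1), (k (some i) : ℚ) = s)

/-- the map counting equivalence classes of rectangles crossing `X₂` (the
`X`-marking of column `c'+1`) once and no other `X`-marking -/
def HX2map {n : ℕ} (G' : GridDiagram (n + 1)) (c' : ZMod (n + 1)) :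
    GC (n + 1) →ₗ[Rng (n + 1)] GC (n + 1) :=
  basisMap fun x => ∑ y : GridState (n + 1),
    ∑ r ∈ Finset.univ.filter (fun r : Rect (2 * (n + 1)) =>
        IsRect4From x y r ∧ normal4 r ∧ X4count G' r (c' + 1) = 1 ∧
        ∀ k, k ≠ c' + 1 → X4count G' r k = 0),
      Finsupp.single y (wt4 G' x y r)

/-- its component `𝓗_{X₂}^{I₄} : N₄ → I₄` -/
def hX2I {n : ℕ} (G' : GridDiagram (n + 1)) (c' r' : ZMod (n + 1)) :
    GC (n + 1) →ₗ[Rng (n + 1)] GC (n + 1) :=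
  pI c' r' ∘ₗ HX2map G' c' ∘ₗ pN c' r'

/-- weight with the variable `V_j` evaluated at `1` -/
def wtNo {n : ℕ} [NeZero n] (G : GridDiagram n) (x y : GridState n) (j : ZMod n)
    (r : Rect (2 * n)) : Rng n :=
  (∏ i ∈ Finset.univ.erase j, Vv i ^ O4count G r i) * vV ^ m4 x y r

/-- `𝓗_{O₁}•`: counts `X`-disjoint rectangles crossing `O₁` (the `O`-marking of
column `c'+1`) once, with `V₁` evaluated at `1` -/
def HO1map {n : ℕ} (G' : GridDiagram (n + 1)) (c' : ZMod (n + 1)) :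
    GC (n + 1) →ₗ[Rng (n + 1)] GC (n + 1) :=
  basisMap fun x => ∑ y : GridState (n + 1),
    ∑ r ∈ Finset.univ.filter (fun r : Rect (2 * (n + 1)) =>
        IsRect4From x y r ∧ normal4 r ∧ XDisjoint4 G' r ∧ O4count G' r (c' + 1) = 1),
      Finsupp.single y (wtNo G' x y (c' + 1) r)

/-- its component `I₄ → N₄` -/
def hO1N {n : ℕ} (G' : GridDiagram (n + 1)) (c' r' : ZMod (n + 1)) :
    GC (n + 1) →ₗ[Rng (n + 1)] GC (n + 1) :=
  pN c' r' ∘ₗ HO1map G' c' ∘ₗ pI c' r'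

/-! ### Grid diagrams of arbitrary size, and the moves of Cromwell's theorem -/

/-- a grid diagram of unspecified (positive) grid number -/
structure GDS where
  sz : ℕ+
  D : GridDiagram (sz : ℕ)

instance (p : ℕ+) : NeZero (p : ℕ) := ⟨p.ne_zero⟩

/-- a single commutation or stabilization move -/
def MoveRel (A B : GDS) : Prop :=
  (∃ h : (A.sz : ℕ) = (B.sz : ℕ),
      IsColComm (h ▸ A.D) B.D ∨ IsRowComm (h ▸ A.D) B.D) ∨
  (∃ h : (B.sz : ℕ) = (A.sz : ℕ) + 1, IsStab A.D (h ▸ B.D))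

/-- connected by a finite sequence of commutation moves and
stabilization/destabilization moves -/
def ConnectedByMoves (A B : GDS) : Prop :=
  Relation.ReflTransGen (fun X Y => MoveRel X Y ∨ MoveRel Y X) A B

/-- `π₄(r₄) = r`: the rectangle `r` of `𝔾` is the projection of `r₄`, i.e. the
multiplicity of `r` at each square is the total multiplicity of `r₄` on its fiber. -/
def projRect {n : ℕ} [NeZero n] (r4 : Rect (2 * n)) (r : Rect n) : Prop :=
  ∀ sq : ZMod n × ZMod n,
    (r.mult sq : ℤ) = ∑ p : ZMod (2 * n) × ZMod (2 * n),
      if pr p.1 = sq.1 ∧ pr p.2 = sq.2 then (r4.mult p : ℤ) else 0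

theorem pr_add' {n : ℕ} (a b : ZMod (2 * n)) : pr (a + b) = pr a + pr b := by
  simp only [pr, map_add]

theorem pr_sub' {n : ℕ} (a b : ZMod (2 * n)) : pr (a - b) = pr a - pr b := by
  simp only [pr, map_sub]

theorem pr_natCast' {n : ℕ} (a : ℕ) : pr (a : ZMod (2 * n)) = (a : ZMod n) := by
  simp only [pr, map_natCast]

theorem pr_val' {n : ℕ} [NeZero n] (d : ZMod (2 * n)) (hd : d.val < n) :
    (pr d).val = d.val := by
  conv_lhs => rw [← ZMod.natCast_zmod_val d, pr_natCast']
  exact ZMod.val_cast_of_lt hd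

/-- the lift of `k` lying in the window of length `n` starting at `c` -/
def liftAt {n : ℕ} (c : ZMod (2 * n)) (k : ZMod n) : ZMod (2 * n) :=
  c + ((k - pr c).val : ZMod (2 * n))

theorem pr_liftAt {n : ℕ} [NeZero n] (c : ZMod (2 * n)) (k : ZMod n) :
    pr (liftAt c k) = k := by
  rw [liftAt, pr_add', pr_natCast', ZMod.natCast_zmod_val]; ring

theorem liftAt_val {n : ℕ} [NeZero n] (c : ZMod (2 * n)) (k : ZMod n) :
    (liftAt c k - c).val = (k - pr c).val := by
  have := ZMod.val_lt (k - pr c)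
  rw [liftAt, add_sub_cancel_left]
  exact ZMod.val_cast_of_lt (by omega)

theorem liftAt_uniq {n : ℕ} [NeZero n] (c a : ZMod (2 * n)) (ha : (a - c).val < n) :
    a = liftAt c (pr a) := by
  rw [liftAt, ← pr_sub', pr_val' _ ha, ZMod.natCast_zmod_val]; ring

theorem inIco_liftAt {n : ℕ} [NeZero n] (u v : ZMod (2 * n)) (k : ZMod n)
    (hv : (v - u).val < n) : inIco u v (liftAt u k) ↔ inIco (pr u) (pr v) k := by
  rw [inIco, inIco, liftAt_val, ← pr_sub', pr_val' _ hv]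

theorem inIco_liftAt_of_le {n : ℕ} [NeZero n] (u v : ZMod (2 * n)) (k : ZMod n)
    (hv : n ≤ (v - u).val) : inIco u v (liftAt u k) := by
  rw [inIco, liftAt_val]
  exact lt_of_lt_of_le (ZMod.val_lt _) hv

theorem inIco_left {m : ℕ} [NeZero m] (u v : ZMod m) (h : u ≠ v) : inIco u v u := by
  rw [inIco, sub_self, ZMod.val_zero, Nat.pos_iff_ne_zero, Ne, ZMod.val_eq_zero, sub_eq_zero]
  exact fun e => h e.symm

theorem pr_ne {n : ℕ} [NeZero n] (u v : ZMod (2 * n)) (h : u ≠ v) (hv : (v - u).val < n) :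
    pr u ≠ pr v := by
  intro e
  have h1 := pr_val' _ hv
  rw [pr_sub', e, sub_self, ZMod.val_zero] at h1
  have h2 := (ZMod.val_eq_zero _).1 h1.symm
  exact h (sub_eq_zero.1 h2).symm

theorem pr_n {n : ℕ} : pr (n : ZMod (2 * n)) = 0 := by
  rw [pr_natCast', ZMod.natCast_self]

theorem n_ne {n : ℕ} [NeZero n] : (n : ZMod (2 * n)) ≠ 0 := by
  intro e
  have hp := Nat.pos_of_ne_zero (NeZero.ne n)
  have h1 : (n : ZMod (2 * n)).val = n := ZMod.val_cast_of_lt (by omega)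
  rw [e, ZMod.val_zero] at h1
  omega

theorem proj_small {n : ℕ} [NeZero n] (r4 : Rect (2 * n))
    (hc : (r4.cE - r4.cW).val < n) (hr : (r4.rN - r4.rS).val < n) :
    projRect r4 ⟨pr r4.cW, pr r4.cE, pr r4.rS, pr r4.rN⟩ := by
  rintro ⟨k, j⟩
  rw [Finset.sum_eq_single (liftAt r4.cW k, liftAt r4.rS j)]
  · simp only [pr_liftAt, and_self, if_true, Rect.mult, inIco_liftAt _ _ _ hc,
      inIco_liftAt _ _ _ hr]
  · rintro ⟨a, b⟩ _ hne
    split_ifs with hab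
    · simp only [Rect.mult]
      rw [if_neg]
      · rfl
      · rintro ⟨h1, h2⟩
        apply hne
        have e1 := liftAt_uniq r4.cW a (lt_trans h1 hc)
        have e2 := liftAt_uniq r4.rS b (lt_trans h2 hr)
        simp only at hab
        rw [hab.1] at e1
        rw [hab.2] at e2
        rw [← e1, ← e2]
    · rfl
  · intro h; exact absurd (Finset.mem_univ _) h

theorem proj_pos {n : ℕ} [NeZero n] {r4 : Rect (2 * n)} {r : Rect n} (h : projRect r4 r)
    (p : ZMod (2 * n) × ZMod (2 * n)) (h1 : inIco r4.cW r4.cE p.1)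
    (h2 : inIco r4.rS r4.rN p.2) :
    inIco r.cW r.cE (pr p.1) ∧ inIco r.rS r.rN (pr p.2) := by
  by_contra hcon
  have h3 := h (pr p.1, pr p.2)
  have h0 : r.mult (pr p.1, pr p.2) = 0 := by
    simp only [Rect.mult]; rw [if_neg hcon]
  rw [h0] at h3
  have h4 := (Finset.sum_eq_zero_iff_of_nonneg (by
    intro q _
    split_ifs
    · exact Int.natCast_nonneg _
    · exact le_refl _)).1 h3.symm p (Finset.mem_univ _)
  simp [Rect.mult, h1, h2] at h4

theorem stInd_sub_one {n : ℕ} (x y : GridState n) (p : ZMod (2 * n) × ZMod (2 * n))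
    (h : (1 : ℤ) = stInd y p - stInd x p) : y (pr p.1) = pr p.2 := by
  unfold stInd at h
  by_contra hc
  rw [if_neg hc] at h
  split_ifs at h <;> omega

theorem rect_small {n : ℕ} [NeZero n] (x y : GridState n) (r4 : Rect (2 * n))
    (h : IsRect4From x y r4)
    (hc : (r4.cE - r4.cW).val < n) (hr : (r4.rN - r4.rS).val < n) :
    IsRectFrom x y ⟨pr r4.cW, pr r4.cE, pr r4.rS, pr r4.rN⟩ := by
  obtain ⟨hcn, hrn, hA, hB⟩ := h
  have pc := pr_ne _ _ hcn hc
  have pq := pr_ne _ _ hrn hr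
  have key : ∀ u v : ZMod (2 * n), pr u ≠ pr v → u ≠ v ∧ v ≠ u ∧
      u ≠ v + (n : ZMod (2 * n)) ∧ v ≠ u + (n : ZMod (2 * n)) := by
    intro u v huv
    refine ⟨?_, ?_, ?_, ?_⟩ <;> intro e <;> apply huv
    · rw [e]
    · rw [e]
    · rw [e, pr_add', pr_n, add_zero]
    · rw [e, pr_add', pr_n, add_zero]
  obtain ⟨c1, c2, c3, c4⟩ := key _ _ pc
  obtain ⟨q1, q2, q3, q4⟩ := key _ _ pq
  have hn := @n_ne n _
  refine ⟨pc, pq, ?_, ?_, ?_, ?_, ?_⟩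
  · apply stInd_sub_one y x (r4.cW, r4.rS)
    rw [← hB]
    simp [cornerB, trN, trE, c1, c2, c3, c4, q1, q2, q3, q4, hn]
  · apply stInd_sub_one y x (r4.cE, r4.rN)
    rw [← hB]
    simp [cornerB, trN, trE, c1, c2, c3, c4, q1, q2, q3, q4, hn]
  · apply stInd_sub_one x y (r4.cW, r4.rN)
    rw [← hA]
    simp [cornerA, trN, trE, c1, c2, c3, c4, q1, q2, q3, q4, hn]
  · apply stInd_sub_one x y (r4.cE, r4.rS)
    rw [← hA]
    simp [cornerA, trN, trE, c1, c2, c3, c4, q1, q2, q3, q4, hn]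
  · intro k hk1 hk2
    simp only at hk1 hk2
    have h1 := hA (liftAt 0 k, liftAt 0 (x k))
    obtain ⟨a1, a2, a3, a4⟩ := key (liftAt 0 k) r4.cW (by rw [pr_liftAt]; exact hk1)
    obtain ⟨b1, b2, b3, b4⟩ := key (liftAt 0 k) r4.cE (by rw [pr_liftAt]; exact hk2)
    simp [cornerA, trN, trE, a1, a3, b1, b3, stInd, pr_liftAt] at h1
    by_contra hcon
    rw [if_neg (fun e => hcon e.symm)] at h1
    omega

theorem x4_ne {n : ℕ} [NeZero n] (G : GridDiagram n) (r : Rect (2 * n))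
    (p : ZMod (2 * n) × ZMod (2 * n)) (h1 : inIco r.cW r.cE p.1)
    (h2 : inIco r.rS r.rN p.2) (h : pr p.2 = G.Xrow (pr p.1)) :
    X4count G r (pr p.1) ≠ 0 := by
  intro h3
  have h4 := (Finset.sum_eq_zero_iff.1 h3) p (Finset.mem_univ _)
  simp [Rect.mult, h1, h2, h] at h4

theorem long_meets {n : ℕ} [NeZero n] (G : GridDiagram n) (r' : Rect (2 * n))
    (hc : r'.cW ≠ r'.cE) (hr : r'.rS ≠ r'.rN)
    (h : n ≤ (r'.cE - r'.cW).val ∨ n ≤ (r'.rN - r'.rS).val) :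
    ∃ i, X4count G r' i ≠ 0 := by
  rcases h with h | h
  · obtain ⟨k, hk⟩ := G.hX.2 (pr r'.rS)
    refine ⟨_, x4_ne G r' (liftAt r'.cW k, r'.rS) (inIco_liftAt_of_le _ _ _ h)
      (inIco_left _ _ hr) ?_⟩
    rw [pr_liftAt, hk]
  · refine ⟨_, x4_ne G r' (r'.cW, liftAt r'.rS (G.Xrow (pr r'.cW))) (inIco_left _ _ hc)
      (inIco_liftAt_of_le _ _ _ h) ?_⟩
    rw [pr_liftAt]

/-- A rectangle `r₄` from `x₄` to `y₄` determines a class in the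
image of the natural injection `Rect(x,y) ↪ [Rect](x₄,y₄)` iff both its edges span
fewer than `n` rows/columns; any rectangle of `𝔾₄` with an edge spanning at least
`n` rows or columns meets `π₄⁻¹(𝕏)`; consequently every class with
`r₄ ∩ π₄⁻¹(𝕏) = ∅` lies in the image of `Rect(x,y)`. -/
theorem statement6 (n : ℕ) [NeZero n] (G : GridDiagram n) (x y : GridState n)
    (r4 : Rect (2 * n)) (h : IsRect4From x y r4) :
    ((∃ r : Rect n, IsRectFrom x y r ∧ projRect r4 r)
        ↔ (r4.cE - r4.cW).val < n ∧ (r4.rN - r4.rS).val < n) ∧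
    (∀ r' : Rect (2 * n), r'.cW ≠ r'.cE → r'.rS ≠ r'.rN →
        (n ≤ (r'.cE - r'.cW).val ∨ n ≤ (r'.rN - r'.rS).val) →
        ∃ i, X4count G r' i ≠ 0) ∧
    (XDisjoint4 G r4 → ∃ r : Rect n, IsRectFrom x y r ∧ projRect r4 r) := by
  have back : (r4.cE - r4.cW).val < n ∧ (r4.rN - r4.rS).val < n →
      ∃ r : Rect n, IsRectFrom x y r ∧ projRect r4 r := fun hh =>
    ⟨_, rect_small x y r4 h hh.1 hh.2, proj_small r4 hh.1 hh.2⟩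
  refine ⟨⟨?_, back⟩, fun r' => long_meets G r', ?_⟩
  · rintro ⟨r, -, hp⟩
    constructor
    · by_contra hcon
      have h1 := (proj_pos hp (liftAt r4.cW r.cE, r4.rS)
        (inIco_liftAt_of_le _ _ _ (not_lt.1 hcon)) (inIco_left _ _ h.2.1)).1
      rw [pr_liftAt] at h1
      exact lt_irrefl _ h1
    · by_contra hcon
      have h1 := (proj_pos hp (r4.cW, liftAt r4.rS r.rN)
        (inIco_left _ _ h.1) (inIco_liftAt_of_le _ _ _ (not_lt.1 hcon))).2
      rw [pr_liftAt] at h1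
      exact lt_irrefl _ h1
  · intro hX
    apply back
    by_contra hcon
    rw [not_and_or, not_lt, not_lt] at hcon
    obtain ⟨i, hi⟩ := long_meets G r4 h.1 h.2.1 hcon
    exact hi (hX i)

end GridHomology
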